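/- arXiv:2406.11221 — 2 statements merged into one kernel-verified Lean document; each statement's English description precedes it below -/
import Mathlib

section
/- Let X be a compact Hausdorff space with a finite closed cover X = X_1 ∪ ⋯ ∪ X_n, and let φ : M → N be a continuous C(X,ℂ)-linear map between unital Banach C(X,ℂ)-modules. For each i, φ induces a map M / closure(I_{X_i} • M) → N / closure(I_{X_i} • N). If every induced map is injective, then φ is injective; if every induced map is bijective, then φ is bijective. -/
/-- The ideal of continuous functions vanishing on the subset `Y`. -/
noncomputable def IY {X : Type*} [TopologicalSpace X] (Y : Set X) : Ideal C(X, ℂ) where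
  carrier := {f : C(X, ℂ) | ∀ y ∈ Y, f y = 0}
  add_mem' := by
    intro a b ha hb y hy
    simp [ha y hy, hb y hy]
  zero_mem' := by
    intro y hy
    simp
  smul_mem' := by
    intro c f hf y hy
    simp [hf y hy]

theorem ContinuousMap.norm_smul_le_of_norm_le_one {X M : Type*} [TopologicalSpace X]
    [CompactSpace X] [NormedAddCommGroup M] [Module C(X, ℂ) M]
    (hM : ∀ (f : C(X, ℂ)) (m : M), ‖f • m‖ ≤ ‖f‖ * ‖m‖)
    {u : C(X, ℂ)} (hu : ‖u‖ ≤ 1) (m : M) : ‖u • m‖ ≤ ‖m‖ :=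
  (hM u m).trans (mul_le_of_le_one_left (norm_nonneg m) hu)

/-- A function vanishing on `Y` is nearly annihilated by a contraction equal to `1` on `Y`. -/
theorem IY.exists_norm_mul_le {X : Type*} [TopologicalSpace X] [CompactSpace X] {Y : Set X}
    {f : C(X, ℂ)} (hf : f ∈ IY Y) {δ : ℝ} (hδ : 0 < δ) :
    ∃ u : C(X, ℂ), ‖u‖ ≤ 1 ∧ (∀ y ∈ Y, u y = 1) ∧ ‖u * f‖ ≤ δ := by
  have hpos : ∀ x, 0 < δ + ‖f x‖ := fun x => by positivity
  refine ⟨⟨fun x => ((δ / (δ + ‖f x‖) : ℝ) : ℂ), ?_⟩, ?_, ?_, ?_⟩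
  · refine Complex.continuous_ofReal.comp (continuous_const.div (by fun_prop) fun x => ?_)
    exact (hpos x).ne'
  · refine (ContinuousMap.norm_le _ zero_le_one).2 fun x => ?_
    have h := hpos x
    simp only [ContinuousMap.coe_mk, Complex.norm_real, Real.norm_eq_abs]
    rw [abs_of_nonneg (by positivity), div_le_one h]
    linarith [norm_nonneg (f x)]
  · intro y hy
    have h : f y = 0 := hf y hy
    simp [h, hδ.ne']
  · refine (ContinuousMap.norm_le _ hδ.le).2 fun x => ?_
    have h := hpos x
    simp only [ContinuousMap.mul_apply, ContinuousMap.coe_mk, norm_mul, Complex.norm_real,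
      Real.norm_eq_abs]
    rw [abs_of_nonneg (by positivity), div_mul_eq_mul_div, div_le_iff₀ h]
    nlinarith [norm_nonneg (f x)]

/-- Elements of the closure of `IY Y • M` are nearly annihilated by contractions equal to `1`
on `Y`. -/
theorem IY.exists_norm_smul_lt {X M : Type*} [TopologicalSpace X] [CompactSpace X]
    [NormedAddCommGroup M] [Module C(X, ℂ) M]
    (hM : ∀ (f : C(X, ℂ)) (m : M), ‖f • m‖ ≤ ‖f‖ * ‖m‖) {Y : Set X} {m : M}
    (hm : m ∈ closure ((IY Y • (⊤ : Submodule C(X, ℂ) M) : Submodule C(X, ℂ) M) : Set M))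
    {ε : ℝ} (hε : 0 < ε) :
    ∃ u : C(X, ℂ), ‖u‖ ≤ 1 ∧ (∀ y ∈ Y, u y = 1) ∧ ‖u • m‖ < ε := by
  have key : ∀ m ∈ (IY Y • (⊤ : Submodule C(X, ℂ) M) : Submodule C(X, ℂ) M), ∀ ε : ℝ, 0 < ε →
      ∃ u : C(X, ℂ), ‖u‖ ≤ 1 ∧ (∀ y ∈ Y, u y = 1) ∧ ‖u • m‖ < ε := by
    intro m hm
    refine Submodule.smul_induction_on hm (fun f hf m _ ε hε => ?_) (fun a b ha hb ε hε => ?_)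
    · obtain ⟨u, hu, hu1, huf⟩ :=
        IY.exists_norm_mul_le hf (δ := ε / (‖m‖ + 1)) (by positivity)
      refine ⟨u, hu, hu1, ?_⟩
      rw [← mul_smul]
      calc ‖(u * f) • m‖ ≤ ‖u * f‖ * ‖m‖ := hM _ _
        _ ≤ ε / (‖m‖ + 1) * ‖m‖ := by gcongr
        _ < ε := by
          rw [div_mul_eq_mul_div, div_lt_iff₀ (by positivity)]
          nlinarith
    · obtain ⟨u, hu, hu1, hua⟩ := ha (ε / 2) (by positivity)
      obtain ⟨v, hv, hv1, hvb⟩ := hb (ε / 2) (by positivity)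
      refine ⟨u * v, (norm_mul_le u v).trans (mul_le_one₀ hu (norm_nonneg v) hv),
        fun y hy => by simp [hu1 y hy, hv1 y hy], ?_⟩
      have e : (u * v) • (a + b) = v • u • a + u • v • b := by
        rw [smul_add, mul_smul u v b, mul_comm u v, mul_smul]
      rw [e]
      have h1 := ContinuousMap.norm_smul_le_of_norm_le_one hM hv (u • a)
      have h2 := ContinuousMap.norm_smul_le_of_norm_le_one hM hu (v • b)
      linarith [norm_add_le (v • u • a) (u • v • b)]
  obtain ⟨b, hb, hmb⟩ := Metric.mem_closure_iff.1 hm (ε / 2) (by positivity)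
  obtain ⟨u, hu, hu1, hub⟩ := key b hb (ε / 2) (by positivity)
  refine ⟨u, hu, hu1, ?_⟩
  have e : u • m = u • (m - b) + u • b := by rw [← smul_add, sub_add_cancel]
  have h1 := ContinuousMap.norm_smul_le_of_norm_le_one hM hu (m - b)
  rw [dist_eq_norm] at hmb
  rw [e]
  linarith [norm_add_le (u • (m - b)) (u • b)]

/-- Contractions equal to `1` on the members of a finite cover generate the unit ideal, with
coefficients bounded in terms of the size of the cover. -/
theorem ContinuousMap.exists_sum_mul_eq_one_of_cover {X : Type*} [TopologicalSpace X]
    [CompactSpace X] {n : ℕ} {Y : Fin n → Set X} (hY : ⋃ i, Y i = Set.univ)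
    {u : Fin n → C(X, ℂ)} (hu : ∀ i, ‖u i‖ ≤ 1) (hu1 : ∀ i, ∀ y ∈ Y i, u i y = 1) :
    ∃ v : Fin n → C(X, ℂ), (∀ i, ‖v i‖ ≤ 2 ^ n) ∧ ∑ i, v i * u i = 1 := by
  refine ⟨fun i => ∏ j with j < i, (1 - u j), fun i => ?_, ?_⟩
  · refine (ContinuousMap.norm_le _ (by positivity)).2 fun x => ?_
    rw [ContinuousMap.prod_apply, norm_prod]
    calc ∏ j with j < i, ‖(1 - u j) x‖ ≤ ∏ j : Fin n with j < i, (2 : ℝ) := by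
          refine Finset.prod_le_prod (fun _ _ => norm_nonneg _) fun j _ => ?_
          have h1 := ((u j).norm_coe_le_norm x).trans (hu j)
          have h2 := norm_sub_le (1 : ℂ) (u j x)
          rw [norm_one] at h2
          simp only [ContinuousMap.sub_apply, ContinuousMap.one_apply]
          linarith
      _ ≤ 2 ^ n := by
          rw [Finset.prod_const]
          refine pow_le_pow_right₀ one_le_two ((Finset.card_le_univ _).trans_eq ?_)
          exact Fintype.card_fin n
  · have h0 : ∏ i, (1 - u i) = 0 := by
      ext x
      obtain ⟨i, hi⟩ := Set.mem_iUnion.1 (hY ▸ Set.mem_univ x)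
      rw [ContinuousMap.prod_apply]
      exact Finset.prod_eq_zero (Finset.mem_univ i) (by simp [hu1 i x hi])
    rw [Finset.prod_one_sub_ordered] at h0
    simp_rw [mul_comm _ (u _)]
    exact (sub_eq_zero.1 h0).symm

theorem ContinuousMap.norm_sum_smul_smul_le {X M : Type*} [TopologicalSpace X] [CompactSpace X]
    [NormedAddCommGroup M] [Module C(X, ℂ) M]
    (hM : ∀ (f : C(X, ℂ)) (m : M), ‖f • m‖ ≤ ‖f‖ * ‖m‖) {n : ℕ} {u v : Fin n → C(X, ℂ)}
    {K r : ℝ} (hv : ∀ i, ‖v i‖ ≤ K) {x : Fin n → M} (hx : ∀ i, ‖u i • x i‖ ≤ r) :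
    ‖∑ i, (v i * u i) • x i‖ ≤ n * (K * r) := by
  calc ‖∑ i, (v i * u i) • x i‖ ≤ ∑ _i : Fin n, K * r := by
        refine norm_sum_le_of_le _ fun i _ => ?_
        rw [mul_smul]
        exact (hM _ _).trans (mul_le_mul (hv i) (hx i) (norm_nonneg _)
          ((norm_nonneg _).trans (hv i)))
    _ = n * (K * r) := by simp

/-- The norm of a Banach `C(X,ℂ)`-module is controlled by its quotient norms over the members of
a finite cover. -/
theorem IY.norm_le_of_forall_sub_mem_closure {X M : Type*} [TopologicalSpace X] [CompactSpace X]
    [NormedAddCommGroup M] [Module C(X, ℂ) M]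
    (hM : ∀ (f : C(X, ℂ)) (m : M), ‖f • m‖ ≤ ‖f‖ * ‖m‖) {n : ℕ} {Y : Fin n → Set X}
    (hY : ⋃ i, Y i = Set.univ) {m : M} {r : ℝ}
    (h : ∀ i, ∃ m' : M, ‖m'‖ ≤ r ∧
      m - m' ∈ closure ((IY (Y i) • (⊤ : Submodule C(X, ℂ) M) : Submodule C(X, ℂ) M) : Set M)) :
    ‖m‖ ≤ n * (2 ^ n * r) := by
  have approx : ∀ ε : ℝ, 0 < ε → ‖m‖ ≤ n * (2 ^ n * (r + ε)) := by
    intro ε hε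
    choose m' hm' hmem using h
    choose u hu hu1 hum using fun i => IY.exists_norm_smul_lt hM (hmem i) hε
    obtain ⟨v, hv, hvu⟩ := ContinuousMap.exists_sum_mul_eq_one_of_cover hY hu hu1
    have hx : ∀ i, ‖u i • m‖ ≤ r + ε := fun i => by
      have e : u i • m = u i • m' i + u i • (m - m' i) := by
        rw [← smul_add, add_sub_cancel]
      have h1 := ContinuousMap.norm_smul_le_of_norm_le_one hM (hu i) (m' i)
      rw [e]
      linarith [norm_add_le (u i • m' i) (u i • (m - m' i)), hm' i, hum i]
    have hle := ContinuousMap.norm_sum_smul_smul_le hM hv hx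
    rwa [← Finset.sum_smul, hvu, one_smul] at hle
  have hlim : Filter.Tendsto (fun ε : ℝ => n * (2 ^ n * (r + ε))) (nhdsWithin 0 (Set.Ioi 0))
      (nhds (n * (2 ^ n * (r + 0)))) :=
    ((by fun_prop : Continuous fun ε : ℝ => n * (2 ^ n * (r + ε))).tendsto 0).mono_left
      nhdsWithin_le_nhds
  rw [add_zero] at hlim
  exact ge_of_tendsto hlim (Filter.eventually_of_mem self_mem_nhdsWithin fun ε hε => approx ε hε)

/-- Open mapping theorem modulo a closed submodule. -/
theorem ContinuousLinearMap.exists_bound_sub_mem_closure {X M N : Type*} [TopologicalSpace X]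
    [CompactSpace X] [NormedAddCommGroup M] [CompleteSpace M] [Module C(X, ℂ) M]
    [NormedAddCommGroup N] [CompleteSpace N] [Module C(X, ℂ) N]
    (hM : ∀ (f : C(X, ℂ)) (m : M), ‖f • m‖ ≤ ‖f‖ * ‖m‖)
    (hN : ∀ (f : C(X, ℂ)) (y : N), ‖f • y‖ ≤ ‖f‖ * ‖y‖)
    (φ : M →L[C(X, ℂ)] N) (S : Submodule C(X, ℂ) N)
    (hS : ∀ y : N, ∃ m : M, y - φ m ∈ closure (S : Set N)) :
    ∃ C : ℝ, 0 < C ∧ ∀ y : N, ∃ m : M, ‖m‖ ≤ C * ‖y‖ ∧ y - φ m ∈ closure (S : Set N) := by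
  have hc : ∀ c : ℂ, ‖algebraMap ℂ C(X, ℂ) c‖ ≤ ‖c‖ := fun c =>
    (ContinuousMap.norm_le _ (norm_nonneg c)).2 fun x => by simp
  let _ : Module ℂ M := Module.compHom M (algebraMap ℂ C(X, ℂ))
  let _ : Module ℂ N := Module.compHom N (algebraMap ℂ C(X, ℂ))
  let _ : NormedSpace ℂ M := ⟨fun c m =>
    (hM (algebraMap ℂ C(X, ℂ) c) m).trans (by gcongr; exact hc c)⟩
  let _ : NormedSpace ℂ N := ⟨fun c m =>
    (hN (algebraMap ℂ C(X, ℂ) c) m).trans (by gcongr; exact hc c)⟩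
  have _ : IsScalarTower ℂ C(X, ℂ) M := ⟨fun c f m => by
    rw [Algebra.smul_def, mul_smul]; rfl⟩
  have _ : IsScalarTower ℂ C(X, ℂ) N := ⟨fun c f m => by
    rw [Algebra.smul_def, mul_smul]; rfl⟩
  let Q : Submodule ℂ N := (S.restrictScalars ℂ).topologicalClosure
  have _ : CompleteSpace Q :=
    (Submodule.isClosed_topologicalClosure (S.restrictScalars ℂ)).completeSpace_coe
  let T : M × Q →L[ℂ] N := (φ.restrictScalars ℂ).coprod Q.subtypeL
  have hT : Function.Surjective T := fun y => by
    obtain ⟨m, hm⟩ := hS y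
    exact ⟨(m, ⟨y - φ m, hm⟩), add_sub_cancel (φ m) y⟩
  obtain ⟨C, hC, h⟩ := T.exists_preimage_norm_le hT
  refine ⟨C, hC, fun y => ?_⟩
  obtain ⟨⟨m, q⟩, rfl, hle⟩ := h y
  refine ⟨m, (le_max_left ‖m‖ ‖q‖).trans hle, ?_⟩
  have e : T (m, q) - φ m = q := add_sub_cancel_left (φ m) (q : N)
  rw [e]
  exact q.2


/-- Given a finite closed cover `X = X_1 ∪ ⋯ ∪ X_n` of a compact Hausdorff
space and a continuous `C(X,ℂ)`-linear map `φ : M → N` of unital Banach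
`C(X,ℂ)`-modules: if all the induced maps
`M / closure(I_{X_i} • M) → N / closure(I_{X_i} • N)` are injective then `φ`
is injective, and if they are all bijective then `φ` is bijective.
(Injectivity of the induced map on quotients is expressed by the preimage
condition `φ m ∈ closure(I_{X_i} • N) → m ∈ closure(I_{X_i} • M)`, and its
surjectivity by `∀ y, ∃ m, y - φ m ∈ closure(I_{X_i} • N)`.) -/
theorem stmt5 {X M N : Type*} [TopologicalSpace X] [CompactSpace X] [T2Space X]
    [NormedAddCommGroup M] [CompleteSpace M] [Module C(X, ℂ) M]
    [NormedAddCommGroup N] [CompleteSpace N] [Module C(X, ℂ) N]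
    (hnormM : ∀ (f : C(X, ℂ)) (m : M), ‖f • m‖ ≤ ‖f‖ * ‖m‖)
    (hnormN : ∀ (f : C(X, ℂ)) (y : N), ‖f • y‖ ≤ ‖f‖ * ‖y‖)
    (n : ℕ) (hn : 0 < n) (Xi : Fin n → Set X)
    (hcl : ∀ i, IsClosed (Xi i)) (hcov : ⋃ i, Xi i = Set.univ)
    (φ : M →L[C(X, ℂ)] N) :
    ((∀ i, ∀ m : M,
        φ m ∈ closure ((IY (Xi i) • (⊤ : Submodule C(X, ℂ) N) : Submodule C(X, ℂ) N) : Set N) →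
        m ∈ closure ((IY (Xi i) • (⊤ : Submodule C(X, ℂ) M) : Submodule C(X, ℂ) M) : Set M)) →
      Function.Injective φ) ∧
    ((∀ i,
        (∀ m : M,
          φ m ∈ closure ((IY (Xi i) • (⊤ : Submodule C(X, ℂ) N) : Submodule C(X, ℂ) N) : Set N) →
          m ∈ closure ((IY (Xi i) • (⊤ : Submodule C(X, ℂ) M) : Submodule C(X, ℂ) M) : Set M)) ∧
        (∀ y : N, ∃ m : M, y - φ m ∈
          closure ((IY (Xi i) • (⊤ : Submodule C(X, ℂ) N) : Submodule C(X, ℂ) N) : Set N))) →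
      Function.Bijective φ) := by
  refine ⟨fun hinj => ?_, fun hbij => ?_⟩
  · refine (injective_iff_map_eq_zero φ).2 fun m hm => ?_
    have h := IY.norm_le_of_forall_sub_mem_closure hnormM hcov (m := m) (r := 0) fun i =>
      ⟨0, norm_zero.le, by
        rw [sub_zero]
        exact hinj i m (hm ▸ subset_closure (Submodule.zero_mem _))⟩
    simpa using h
  · choose hinj hsurj using hbij
    choose C hC hCb using fun i =>
      φ.exists_bound_sub_mem_closure hnormM hnormN _ (hsurj i)
    have hbelow : ∀ m, ‖m‖ ≤ n * (2 ^ n * ∑ i, C i) * ‖φ m‖ := fun m => by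
      have h := IY.norm_le_of_forall_sub_mem_closure hnormM hcov (m := m)
        (r := (∑ i, C i) * ‖φ m‖) fun i => by
          obtain ⟨m', hle, hmem⟩ := hCb i (φ m)
          refine ⟨m', hle.trans ?_, hinj i _ (by rwa [map_sub])⟩
          gcongr
          exact Finset.single_le_sum (fun j _ => (hC j).le) (Finset.mem_univ i)
      linarith
    have hK : 0 ≤ n * (2 ^ n * ∑ i, C i) :=
      mul_nonneg n.cast_nonneg (mul_nonneg (by positivity) (Finset.sum_nonneg fun i _ => (hC i).le))
    have hanti : AntilipschitzWith ⟨n * (2 ^ n * ∑ i, C i), hK⟩ φ :=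
      AddMonoidHomClass.antilipschitz_of_bound φ hbelow
    have hunif : UniformContinuous φ :=
      uniformContinuous_addMonoidHom_of_continuous φ.continuous
    refine ⟨hanti.injective, Set.range_eq_univ.1 ?_⟩
    rw [← (hanti.isClosed_range hunif).closure_eq]
    refine Set.eq_univ_of_forall fun y => Metric.mem_closure_iff.2 fun ε hε => ?_
    have hδ : 0 < ε / (n * 2 ^ n + 1) := by positivity
    choose m hm using fun i => hsurj i y
    choose u hu hu1 hum using fun i => IY.exists_norm_smul_lt hnormN (hm i) hδ
    obtain ⟨v, hv, hvu⟩ := ContinuousMap.exists_sum_mul_eq_one_of_cover hcov hu hu1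
    refine ⟨φ (∑ i, (v i * u i) • m i), Set.mem_range_self _, ?_⟩
    have e : y - φ (∑ i, (v i * u i) • m i) = ∑ i, (v i * u i) • (y - φ (m i)) := by
      simp_rw [smul_sub, Finset.sum_sub_distrib, ← Finset.sum_smul, hvu, one_smul, map_sum,
        map_smul]
    rw [dist_eq_norm, e]
    refine (ContinuousMap.norm_sum_smul_smul_le hnormN hv fun i => (hum i).le).trans_lt ?_
    rw [← mul_assoc, mul_div_assoc', div_lt_iff₀ (by positivity)]
    linarith
end

section
/- Let X be a compact Hausdorff space and M a unital Banach C(X,ℂ)-module that is C(X)-convex, has continuous fiber norms, and is topologically finitely generated. Then there exist n ≥ 1, closed subsets Y_1, …, Y_n covering X, and for each i finitely many open F_σ subsets U_{i,1}, …, U_{i,k_i} of Y_i, such that the quotient M / closure(I_{Y_i} • M) is isomorphic, via a C(X,ℂ)-linear homeomorphism, to the finite direct sum ⊕_j {f ∈ C(Y_i,ℂ) : f vanishes on Y_i ∖ U_{i,j}}. -/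
/-- A real-valued continuous function regarded as a complex-valued one. -/
noncomputable def ofRealCM {X : Type*} [TopologicalSpace X] (f : C(X, ℝ)) : C(X, ℂ) :=
  ⟨fun x => (f x : ℂ), Complex.continuous_ofReal.comp f.continuous⟩
open Topology Filter Set

section Frames

variable {X M : Type*} [AddCommGroup M] [Module ℂ M]

/-- The seminorm induced by `p` on the quotient by the line spanned by `s`, pulled back to `M`. -/
noncomputable def Seminorm.modLine (p : Seminorm ℂ M) (s : M) : Seminorm ℂ M :=
  have bdd (m : M) : BddBelow (range fun c : ℂ => p (m - c • s)) :=
    ⟨0, by rintro _ ⟨c, rfl⟩; exact apply_nonneg p _⟩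
  Seminorm.ofSMulLE (fun m => ⨅ c : ℂ, p (m - c • s))
    (le_antisymm ((ciInf_le (bdd 0) 0).trans (by simp)) (le_ciInf fun c => apply_nonneg p _))
    (fun x y => by
      refine le_ciInf_add_ciInf fun c d => (ciInf_le (bdd _) (c + d)).trans ?_
      refine le_trans (le_of_eq ?_) (map_add_le_add p _ _)
      congr 1
      module)
    (fun r x => by
      rw [Real.mul_iInf_of_nonneg (norm_nonneg r)]
      refine le_ciInf fun c => (ciInf_le (bdd _) (r * c)).trans ?_
      rw [← map_smul_eq_mul p, smul_sub, smul_smul])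

namespace Seminorm

variable (p : Seminorm ℂ M) (s : M)

lemma modLine_le_sub (m : M) (c : ℂ) : p.modLine s m ≤ p (m - c • s) :=
  ciInf_le (f := fun c : ℂ => p (m - c • s))
    ⟨0, by rintro _ ⟨c, rfl⟩; exact apply_nonneg p _⟩ c

lemma modLine_le (m : M) : p.modLine s m ≤ p m := by
  simpa using p.modLine_le_sub s m 0

variable {p s} in
lemma exists_of_modLine_lt {m : M} {r : ℝ} (h : p.modLine s m < r) : ∃ c : ℂ, p (m - c • s) < r :=
  exists_lt_of_ciInf_lt h

lemma modLine_smul_self (c : ℂ) : p.modLine s (c • s) = 0 :=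
  le_antisymm ((p.modLine_le_sub s _ c).trans (by simp)) (apply_nonneg _ _)

variable {p} in
lemma map_eq_of_map_sub_eq_zero {m m' : M} (h : p (m - m') = 0) : p m = p m' := by
  have := abs_sub_map_le_sub p m m'
  rw [h] at this
  exact sub_eq_zero.1 (abs_nonpos_iff.1 this)

lemma modLine_sub_smul (m : M) (c : ℂ) : p.modLine s (m - c • s) = p.modLine s m := by
  refine map_eq_of_map_sub_eq_zero ?_
  rw [show m - c • s - m = (-c) • s by module, modLine_smul_self]

variable {p s} in
lemma exists_map_sub_smul_eq_zero {m : M} (hs : 0 < p s) (hm : p.modLine s m = 0) :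
    ∃ c : ℂ, p (m - c • s) = 0 := by
  have hlip : ∀ c d : ℂ, |p (m - c • s) - p (m - d • s)| ≤ ‖c - d‖ * p s := by
    intro c d
    refine (abs_sub_map_le_sub p _ _).trans (le_of_eq ?_)
    rw [show m - c • s - (m - d • s) = (d - c) • s by module, map_smul_eq_mul, norm_sub_rev]
  have hcont : Continuous fun c : ℂ => p (m - c • s) := by
    refine (LipschitzWith.of_dist_le_mul (K := ⟨p s, hs.le⟩) fun c d => ?_).continuous
    rw [Real.dist_eq, dist_eq_norm, mul_comm]
    exact hlip c d
  have htop : Tendsto (fun c : ℂ => p (m - c • s)) (cocompact ℂ) atTop := by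
    have h₁ : Tendsto (fun c : ℂ => -p m + ‖c‖ * p s) (cocompact ℂ) atTop :=
      tendsto_atTop_add_const_left _ _ (tendsto_norm_cocompact_atTop.atTop_mul_const hs)
    refine tendsto_atTop_mono (fun c => ?_) h₁
    have := map_sub_le_add p m (m - c • s)
    rw [sub_sub_cancel, map_smul_eq_mul] at this
    linarith
  obtain ⟨c, hc⟩ := hcont.exists_forall_le htop
  refine ⟨c, le_antisymm ?_ (apply_nonneg _ _)⟩
  exact (le_ciInf hc).trans hm.le

end Seminorm

variable [TopologicalSpace X]

/-- Finite sums of maps `x ↦ b x • m` with `b` continuous on `W` and `m` a fixed vector. -/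
inductive IsCombOn (W : Set X) : (X → M) → Prop
  | smul {b : X → ℂ} (hb : ContinuousOn b W) (m : M) : IsCombOn W fun x => b x • m
  | add {F G : X → M} (hF : IsCombOn W F) (hG : IsCombOn W G) : IsCombOn W fun x => F x + G x

namespace IsCombOn

variable {W : Set X} {F G : X → M} {p : X → Seminorm ℂ M}

lemma mono {V : Set X} (hF : IsCombOn W F) (h : V ⊆ W) : IsCombOn V F := by
  induction hF with
  | smul hb m => exact .smul (hb.mono h) m
  | add _ _ hF hG => exact .add hF hG

lemma const (m : M) : IsCombOn W fun _ => m := by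
  simpa using IsCombOn.smul (W := W) (b := fun _ => 1) continuousOn_const m

lemma sub_smul (hF : IsCombOn W F) {b : X → ℂ} (hb : ContinuousOn b W) (m : M) :
    IsCombOn W fun x => F x - b x • m := by
  simpa [sub_eq_add_neg] using hF.add (.smul hb.neg m)

lemma const_smul (hF : IsCombOn W F) (c : ℂ) : IsCombOn W fun x => c • F x := by
  induction hF with
  | smul hb m =>
    simpa [smul_smul] using
      IsCombOn.smul (continuousOn_const.mul hb : ContinuousOn (fun x => c * _) W) m
  | add _ _ hF hG => simpa using hF.add hG

lemma sub_sum {k : ℕ} {e : Fin k → X → M} (hF : IsCombOn W F) (a : Fin k → ℂ)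
    (he : ∀ j, a j ≠ 0 → IsCombOn W (e j)) : IsCombOn W fun x => F x - ∑ j, a j • e j x := by
  have h : ∀ t : Finset (Fin k), IsCombOn W fun x => ∑ j ∈ t, a j • e j x := by
    intro t
    induction t using Finset.induction_on with
    | empty => simpa using const (W := W) (0 : M)
    | insert j t hj ih =>
      simp only [Finset.sum_insert hj]
      by_cases h : a j = 0
      · simpa [h] using ih
      · exact ((he j h).const_smul _).add ih
  simpa [sub_eq_add_neg] using hF.add ((h Finset.univ).const_smul (-1))

lemma tendsto_sub (hF : IsCombOn W F) (hp : ∀ m, ContinuousOn (fun x => p x m) W) {x₀ : X}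
    (hx₀ : x₀ ∈ W) : Tendsto (fun x => p x (F x - F x₀)) (𝓝[W] x₀) (𝓝 0) := by
  induction hF with
  | @smul b hb m =>
    have h := ((hb x₀ hx₀).sub_const (b x₀)).norm.mul (hp m x₀ hx₀)
    simpa [← _root_.sub_smul, map_smul_eq_mul] using h
  | @add F G _ _ hF hG =>
    refine squeeze_zero (fun x => apply_nonneg _ _) (fun x => ?_) (by simpa using hF.add hG)
    rw [add_sub_add_comm]
    exact map_add_le_add _ _ _

lemma continuousOn (hF : IsCombOn W F) (hp : ∀ m, ContinuousOn (fun x => p x m) W) :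
    ContinuousOn (fun x => p x (F x)) W := by
  intro x₀ hx₀
  have h : Tendsto (fun x => p x (F x) - p x (F x₀)) (𝓝[W] x₀) (𝓝 0) :=
    squeeze_zero_norm (fun x => abs_sub_map_le_sub (p x) _ _) (hF.tendsto_sub hp hx₀)
  simpa [ContinuousWithinAt] using h.add (hp (F x₀) x₀ hx₀)

end IsCombOn

lemma continuousOn_modLine {p : X → Seminorm ℂ M} {s : M} {Y : Set X}
    (hp : ∀ m, ContinuousOn (fun x => p x m) Y) (hs : ∀ x ∈ Y, p x s = 0 → ∀ m, p x m = 0) (m : M) :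
    ContinuousOn (fun x => (p x).modLine s m) Y := by
  intro x₀ hx₀
  refine tendsto_order.2 ⟨fun a ha => ?_, fun a ha => ?_⟩
  · rcases eq_or_lt_of_le (apply_nonneg (p x₀) s) with h0 | hpos
    · have : a < 0 := ha.trans_le (((p x₀).modLine_le s m).trans (hs x₀ hx₀ h0.symm m).le)
      exact Eventually.of_forall fun x => this.trans_le (apply_nonneg _ _)
    obtain ⟨b, hab, hb⟩ := exists_between ha
    set R : ℝ := 2 * (|b| + p x₀ m + 1) / p x₀ s with hR
    have h₁ : ∀ᶠ x in 𝓝[Y] x₀, ∀ c ∈ Metric.closedBall (0 : ℂ) R, b < p x (m - c • s) := by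
      suffices h : ∀ᶠ x in 𝓝 x₀, ∀ c ∈ Metric.closedBall (0 : ℂ) R, x ∈ Y → b < p x (m - c • s) by
        rw [eventually_nhdsWithin_iff]
        filter_upwards [h] with x hx hxY c hc using hx c hc hxY
      refine (isCompact_closedBall (0 : ℂ) R).eventually_forall_of_forall_eventually
        (P := fun x c => x ∈ Y → b < p x (m - c • s)) fun c _ => ?_
      have hcomb : IsCombOn (Y ×ˢ (univ : Set ℂ)) fun z : X × ℂ => m - z.2 • s :=
        (IsCombOn.const m).sub_smul continuous_snd.continuousOn s
      have hcont := hcomb.continuousOn (p := fun z : X × ℂ => p z.1)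
        (fun m => (hp m).comp continuous_fst.continuousOn fun z hz => hz.1)
      have hz := (hcont (x₀, c) ⟨hx₀, mem_univ _⟩).eventually_const_lt
        (hb.trans_le ((p x₀).modLine_le_sub s m c))
      rw [eventually_nhdsWithin_iff] at hz
      filter_upwards [hz] with z hz hzY using hz ⟨hzY, mem_univ _⟩
    have h₂ := (hp s x₀ hx₀).eventually_const_lt (half_lt_self hpos)
    have h₃ := (hp m x₀ hx₀).eventually_lt_const (lt_add_one (p x₀ m))
    filter_upwards [h₁, h₂, h₃] with x hx₁ hx₂ hx₃
    refine hab.trans_le (le_ciInf fun c => ?_)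
    by_cases hc : ‖c‖ ≤ R
    · exact (hx₁ c (by simpa using hc)).le
    · have h₄ := map_sub_le_add (p x) m (m - c • s)
      rw [sub_sub_cancel, map_smul_eq_mul] at h₄
      have h₅ : R * (p x₀ s / 2) ≤ ‖c‖ * p x s :=
        mul_le_mul (not_le.1 hc).le hx₂.le (by positivity) (norm_nonneg _)
      have h₆ : R * (p x₀ s / 2) = |b| + p x₀ m + 1 := by
        rw [hR]; field_simp
      linarith [le_abs_self b]
  · obtain ⟨c, hc⟩ := Seminorm.exists_of_modLine_lt ha
    filter_upwards [(hp (m - c • s) x₀ hx₀).eventually_lt_const hc] with x hx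
    exact ((p x).modLine_le_sub s m c).trans_lt hx

/-- A uniformly bounded frame for the seminorms `p x`, `x ∈ Z`: the vectors `e j x` with
`0 < δ j x` form a basis modulo the null space of `p x`, with constants controlled by `C`. -/
structure IsFrameOn (p : X → Seminorm ℂ M) (Z : Set X) {k : ℕ} (δ : Fin k → X → ℝ)
    (e : Fin k → X → M) (C : ℝ) : Prop where
  continuousOn : ∀ j, ContinuousOn (δ j) Z
  comb : ∀ j, IsCombOn (Z ∩ {x | 0 < δ j x}) (e j)
  nonneg : 0 ≤ C
  le : ∀ j, ∀ x ∈ Z, 0 < δ j x → p x (e j x) ≤ C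
  coeff_le : ∀ x ∈ Z, ∀ a : Fin k → ℂ, (∀ j, a j ≠ 0 → 0 < δ j x) →
    ∀ j, ‖a j‖ ≤ C * p x (∑ j, a j • e j x)
  span : ∀ x ∈ Z, ∀ m, ∃ a : Fin k → ℂ, (∀ j, a j ≠ 0 → 0 < δ j x) ∧
    p x (m - ∑ j, a j • e j x) = 0

/-- A continuous choice of almost best approximations of a section by multiples of `s`. -/
lemma exists_continuousOn_map_sub_smul_lt {p : X → Seminorm ℂ M} {s : M} {W : Set X}
    [NormalSpace W] [ParacompactSpace W]
    (hp : ∀ m, ContinuousOn (fun x => p x m) W) {F : X → M} (hF : IsCombOn W F) {r : ℝ}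
    (hr : ∀ x ∈ W, (p x).modLine s (F x) < r) :
    ∃ b : X → ℂ, ContinuousOn b W ∧ ∀ x ∈ W, p x (F x - b x • s) < r := by
  obtain ⟨g, hg⟩ := exists_continuous_forall_mem_convex_of_local_const (X := W) (E := ℂ)
    (t := fun x => {b : ℂ | p x (F x - b • s) < r}) (fun x => by
      intro b hb c hc u v hu hv huv
      simp only [mem_ofPred_eq] at hb hc ⊢
      have h : F x - (u • b + v • c) • s = (u : ℂ) • (F x - b • s) + (v : ℂ) • (F x - c • s) := by
        have : F x = ((u : ℂ) + v) • F x := by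
          rw [← Complex.ofReal_add, huv, Complex.ofReal_one, one_smul]
        nth_rewrite 1 [this]
        simp only [Complex.real_smul]
        module
      rw [h]
      refine (map_add_le_add _ _ _).trans_lt ?_
      rw [map_smul_eq_mul, map_smul_eq_mul, Complex.norm_of_nonneg hu, Complex.norm_of_nonneg hv]
      exact convex_Iio r hb hc hu hv huv) (fun x => by
      obtain ⟨c, hc⟩ := Seminorm.exists_of_modLine_lt (hr x x.2)
      refine ⟨c, ?_⟩
      have hcont := (hF.sub_smul (b := fun _ => c) continuousOn_const s).continuousOn hp
      exact (continuousOn_iff_continuous_domRestrict.1 hcont).continuousAt.eventually_lt_const hc)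
  classical
  refine ⟨fun x => if h : x ∈ W then g ⟨x, h⟩ else 0, ?_, fun x hx => ?_⟩
  · rw [continuousOn_iff_continuous_domRestrict]
    convert g.continuous using 2 with x
    simp
  · simpa [hx] using hg ⟨x, hx⟩

lemma paracompactSpace_inter_pos [CompactSpace X] [T2Space X] {Z : Set X} (hZ : IsClosed Z)
    {δ : X → ℝ} (hδ : ContinuousOn δ Z) :
    NormalSpace ↑(Z ∩ {x | 0 < δ x}) ∧ ParacompactSpace ↑(Z ∩ {x | 0 < δ x}) := by
  have hloc : LocallyCompactSpace ↑(Z ∩ {x | 0 < δ x}) := by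
    obtain ⟨u, hu, hu'⟩ := (continuousOn_iff'.1 hδ) (Ioi 0) isOpen_Ioi
    refine IsLocallyClosed.locallyCompactSpace ?_
    have : Z ∩ {x | 0 < δ x} = u ∩ Z := by rw [← hu']; ext; simp [and_comm]
    rw [this]
    exact hu.isLocallyClosed.inter hZ.isLocallyClosed
  have hsig : SigmaCompactSpace ↑(Z ∩ {x | 0 < δ x}) := by
    rw [← isSigmaCompact_iff_sigmaCompactSpace]
    refine ⟨fun n => Z ∩ δ ⁻¹' Ici (1 / ((n : ℝ) + 1)), fun n =>
      (hδ.preimage_isClosed_of_isClosed hZ isClosed_Ici).isCompact, ?_⟩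
    rw [← inter_iUnion]
    congr 1
    ext x
    simp only [mem_iUnion, mem_preimage, mem_Ici, mem_ofPred_eq]
    exact ⟨fun ⟨n, hn⟩ => Nat.one_div_pos_of_nat.trans_le hn,
      fun h => (exists_nat_one_div_lt h).imp fun n hn => hn.le⟩
  exact ⟨inferInstance, inferInstance⟩

lemma IsFrameOn.exists_cons [CompactSpace X] [T2Space X] {p : X → Seminorm ℂ M} {s : M}
    {Z : Set X} (hZ : IsClosed Z) (hp : ∀ m, ContinuousOn (fun x => p x m) Z)
    (hs : ∀ x ∈ Z, p x s = 0 → ∀ m, p x m = 0) {k : ℕ} {δ : Fin k → X → ℝ} {e : Fin k → X → M}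
    {C : ℝ} (h : IsFrameOn (fun x => (p x).modLine s) Z δ e C) :
    ∃ (δ' : Fin (k + 1) → X → ℝ) (e' : Fin (k + 1) → X → M) (C' : ℝ), IsFrameOn p Z δ' e' C' := by
  have hb : ∀ j, ∃ b : X → ℂ, ContinuousOn b (Z ∩ {x | 0 < δ j x}) ∧
      ∀ x ∈ Z ∩ {x | 0 < δ j x}, p x (e j x - b x • s) < C + 1 := by
    intro j
    obtain ⟨_, _⟩ := paracompactSpace_inter_pos hZ (h.continuousOn j)
    exact exists_continuousOn_map_sub_smul_lt (fun m => (hp m).mono inter_subset_left) (h.comb j)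
      fun x hx => (h.le j x hx.1 hx.2).trans_lt (lt_add_one C)
  choose b hbc hb using hb
  set f : Fin k → X → M := fun j x => e j x - b j x • s with hf
  have hC := h.nonneg
  have hmod : ∀ x m (a : Fin k → ℂ), (p x).modLine s (m - ∑ j, a j • f j x) =
      (p x).modLine s (m - ∑ j, a j • e j x) := by
    intro x m a
    rw [← (p x).modLine_sub_smul s (m - ∑ j, a j • f j x) (∑ j, a j * b j x)]
    congr 1
    simp only [hf, smul_sub, Finset.sum_sub_distrib, Finset.sum_smul, mul_smul]
    abel
  have hK : 0 ≤ k * (C * (C + 1)) := by positivity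
  refine ⟨Fin.cons (fun x => p x s) δ, Fin.cons (fun x => ((p x s : ℂ))⁻¹ • s) f,
    1 + C + k * (C * (C + 1)), ?_, ?_, by positivity, ?_, ?_, ?_⟩
  · exact Fin.cases (hp s) h.continuousOn
  · refine Fin.cases ?_ fun j => (h.comb j).sub_smul (hbc j) s
    refine .smul (ContinuousOn.inv₀ ?_ fun x hx => ?_) s
    · exact Complex.continuous_ofReal.comp_continuousOn ((hp s).mono inter_subset_left)
    · exact Complex.ofReal_ne_zero.2 (ne_of_gt hx.2)
  · refine Fin.cases (fun x hx hpos => ?_) fun j x hx hpos => ?_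
    · simp only [Fin.cons_zero] at hpos ⊢
      rw [map_smul_eq_mul, norm_inv, Complex.norm_of_nonneg hpos.le, inv_mul_cancel₀ hpos.ne']
      linarith
    · have := hb j x ⟨hx, hpos⟩
      simp only [Fin.cons_succ, hf]
      linarith
  · intro x hx a ha
    set S := p x (∑ j, a j • (Fin.cons (fun x => ((p x s : ℂ))⁻¹ • s) f : Fin (k + 1) → X → M) j x)
      with hS
    have hS0 : 0 ≤ S := apply_nonneg _ _
    simp only [Fin.sum_univ_succ, Fin.cons_zero, Fin.cons_succ] at hS
    have hsucc : ∀ j : Fin k, ‖a j.succ‖ ≤ C * S := by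
      intro j
      refine (h.coeff_le x hx (fun j => a j.succ) (fun j hj => ha j.succ hj) j).trans
        (mul_le_mul_of_nonneg_left ?_ hC)
      have h₁ := hmod x 0 fun j => a j.succ
      simp only [zero_sub, map_neg_eq_map] at h₁
      rw [← h₁]
      refine ((p x).modLine_le_sub s _ (-(a 0 * (p x s : ℂ)⁻¹))).trans_eq ?_
      rw [hS, smul_smul, neg_smul, sub_neg_eq_add, add_comm]
    refine Fin.cases ?_ fun j => (hsucc j).trans ?_
    · by_cases ha0 : a 0 = 0
      · rw [ha0, norm_zero]; positivity
      have hpos : 0 < p x s := ha 0 ha0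
      have h₁ : p x (a 0 • ((p x s : ℂ)⁻¹ • s)) = ‖a 0‖ := by
        rw [map_smul_eq_mul, map_smul_eq_mul, norm_inv, Complex.norm_of_nonneg hpos.le,
          inv_mul_cancel₀ hpos.ne', mul_one]
      have h₂ : p x (∑ j : Fin k, a j.succ • f j x) ≤ k * (C * (C + 1)) * S := by
        refine (Finset.le_sum_of_subadditive (p x) (map_zero _).le (map_add_le_add _) _ _).trans ?_
        refine (Finset.sum_le_card_nsmul _ _ (C * (C + 1) * S) fun j _ => ?_).trans_eq ?_
        · rw [map_smul_eq_mul]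
          by_cases hj : a j.succ = 0
          · rw [hj, norm_zero, zero_mul]; positivity
          refine (mul_le_mul (hsucc j) (hb j x ⟨hx, ha j.succ hj⟩).le (apply_nonneg _ _)
            (by positivity)).trans_eq (by ring)
        · simp; ring
      have h₃ := map_sub_le_add (p x) (a 0 • ((p x s : ℂ)⁻¹ • s) + ∑ j : Fin k, a j.succ • f j x)
        (∑ j : Fin k, a j.succ • f j x)
      rw [add_sub_cancel_right, h₁, ← hS] at h₃
      have : 0 ≤ C * S := by positivity
      linarith
    · refine mul_le_mul_of_nonneg_right ?_ hS0
      linarith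
  · intro x hx m
    obtain ⟨a, ha, hm⟩ := h.span x hx m
    rcases eq_or_lt_of_le (apply_nonneg (p x) s) with h0 | hpos
    · exact ⟨Fin.cons 0 a, Fin.cases (by simp) ha, hs x hx h0.symm _⟩
    rw [← hmod] at hm
    obtain ⟨c, hc⟩ := Seminorm.exists_map_sub_smul_eq_zero hpos hm
    refine ⟨Fin.cons (c * p x s) a, Fin.cases (fun _ => hpos) ha, ?_⟩
    rw [← hc]
    congr 1
    simp only [Fin.sum_univ_succ, Fin.cons_zero, Fin.cons_succ, smul_smul, mul_assoc]
    rw [mul_inv_cancel₀ (Complex.ofReal_ne_zero.2 hpos.ne'), mul_one]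
    abel

theorem exists_isFrameOn_cover [CompactSpace X] [T2Space X] {n : ℕ} (p : X → Seminorm ℂ M)
    {Y : Set X} (hY : IsClosed Y) (hp : ∀ m, ContinuousOn (fun x => p x m) Y) (s : Fin n → M)
    (hs : ∀ x ∈ Y, ∀ m, ∀ ε > 0, ∃ c : Fin n → ℂ, p x (m - ∑ i, c i • s i) < ε) :
    ∃ (ι : Type) (_ : Finite ι) (_ : Nonempty ι) (Z : ι → Set X), (∀ i, IsClosed (Z i)) ∧
      (∀ i, Z i ⊆ Y) ∧ Y ⊆ ⋃ i, Z i ∧ ∀ i, ∃ (k : ℕ) (δ : Fin k → X → ℝ) (e : Fin k → X → M)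
        (C : ℝ), IsFrameOn p (Z i) δ e C := by
  induction n generalizing p Y with
  | zero =>
    refine ⟨Unit, inferInstance, inferInstance, fun _ => Y, fun _ => hY, fun _ => Subset.rfl,
      subset_iUnion (fun _ : Unit => Y) (), fun _ => ⟨0, Fin.elim0, Fin.elim0, 0, ?_⟩⟩
    refine ⟨fun j => j.elim0, fun j => j.elim0, le_rfl, fun j => j.elim0, fun _ _ _ _ j => j.elim0,
      fun x hx m => ⟨Fin.elim0, fun j => j.elim0, ?_⟩⟩
    refine le_antisymm (le_of_forall_pos_lt_add fun ε hε => ?_) (apply_nonneg _ _)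
    obtain ⟨c, hc⟩ := hs x hx m ε hε
    simpa using hc
  | succ n ih =>
    set T : Fin (n + 1) → Set X := fun i => ⋂ j, {x ∈ Y | p x (s j) ≤ p x (s i)} with hT
    have hTc : ∀ i, IsClosed (T i) := fun i => isClosed_iInter fun j =>
      hY.isClosed_le (hp _) (hp _)
    have hTY : ∀ i, T i ⊆ Y := fun i x hx => (mem_iInter.1 hx i).1
    have hdeg : ∀ i, ∀ x ∈ T i, p x (s i) = 0 → ∀ m, p x m = 0 := by
      intro i x hx h0 m
      have h0' : ∀ j, p x (s j) = 0 := fun j =>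
        le_antisymm ((mem_iInter.1 hx j).2.trans h0.le) (apply_nonneg _ _)
      refine le_antisymm (le_of_forall_pos_lt_add fun ε hε => ?_) (apply_nonneg _ _)
      obtain ⟨c, hc⟩ := hs x (hTY i hx) m ε hε
      have h₁ : p x (∑ i, c i • s i) ≤ 0 := by
        refine (Finset.le_sum_of_subadditive (p x) (map_zero _).le (map_add_le_add _) _ _).trans (le_of_eq ?_)
        simp [map_smul_eq_mul, h0']
      have h₂ := map_add_le_add (p x) (m - ∑ i, c i • s i) (∑ i, c i • s i)
      rw [sub_add_cancel] at h₂
      linarith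
    have key := fun i => ih (fun x => (p x).modLine (s i)) (hTc i)
      (continuousOn_modLine (fun m => (hp m).mono (hTY i)) (hdeg i)) (s ∘ i.succAbove) (by
        intro x hx m ε hε
        obtain ⟨c, hc⟩ := hs x (hTY i hx) m ε hε
        refine ⟨c ∘ i.succAbove, lt_of_le_of_lt ?_ hc⟩
        refine ((p x).modLine_le_sub (s i) _ (c i)).trans (le_of_eq ?_)
        rw [Fin.sum_univ_succAbove _ i]
        congr 1
        simp only [Function.comp_apply]
        abel)
    choose ι hfin hne Z hZc hZT hTZ hZ using key
    refine ⟨Σ i, ι i, inferInstance, ⟨⟨0, Classical.arbitrary _⟩⟩, fun i => Z i.1 i.2, fun i => hZc _ _,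
      fun i => (hZT _ _).trans (hTY _), fun x hx => ?_, fun i => ?_⟩
    · obtain ⟨i, hi⟩ := Finite.exists_max fun i => p x (s i)
      obtain ⟨j, hj⟩ := mem_iUnion.1 (hTZ i (mem_iInter.2 fun j => ⟨hx, hi j⟩))
      exact mem_iUnion.2 ⟨⟨i, j⟩, hj⟩
    · obtain ⟨k, δ, e, C, h⟩ := hZ i.1 i.2
      exact ⟨k + 1, h.exists_cons (hZc _ _)
        (fun m => (hp m).mono ((hZT _ _).trans (hTY _)))
        fun x hx => hdeg i.1 x (hZT _ _ hx)⟩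

namespace IsFrameOn

variable {p : X → Seminorm ℂ M} {Z : Set X} {k : ℕ} {δ : Fin k → X → ℝ} {e : Fin k → X → M} {C : ℝ}

lemma norm_sub_le (h : IsFrameOn p Z δ e C) {x : X} (hx : x ∈ Z) {m : M} {a a' : Fin k → ℂ}
    (ha : ∀ j, a j ≠ 0 → 0 < δ j x) (ha' : ∀ j, a' j ≠ 0 → 0 < δ j x)
    (hm : p x (m - ∑ j, a j • e j x) = 0) (j : Fin k) :
    ‖a j - a' j‖ ≤ C * p x (m - ∑ j, a' j • e j x) := by
  refine (h.coeff_le x hx (fun j => a j - a' j) (fun j hj => ?_) j).trans_eq ?_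
  · by_contra hδ
    have h₁ : a j = 0 := by_contra fun h => hδ (ha j h)
    have h₂ : a' j = 0 := by_contra fun h => hδ (ha' j h)
    simp [h₁, h₂] at hj
  · congr 1
    symm
    refine Seminorm.map_eq_of_map_sub_eq_zero ?_
    rw [← hm]
    congr 1
    simp only [sub_smul, Finset.sum_sub_distrib]
    abel

lemma eq_of_map_sub_eq_zero (h : IsFrameOn p Z δ e C) {x : X} (hx : x ∈ Z) {m : M}
    {a a' : Fin k → ℂ} (ha : ∀ j, a j ≠ 0 → 0 < δ j x) (ha' : ∀ j, a' j ≠ 0 → 0 < δ j x)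
    (hm : p x (m - ∑ j, a j • e j x) = 0) (hm' : p x (m - ∑ j, a' j • e j x) = 0) : a = a' := by
  funext j
  have := h.norm_sub_le hx ha ha' hm j
  rw [hm', mul_zero] at this
  exact sub_eq_zero.1 (norm_le_zero_iff.1 this)

lemma exists_coordinates (h : IsFrameOn p Z δ e C) (hp : ∀ m, ContinuousOn (fun x => p x m) Z) :
    ∃ π : M → Fin k → C(Z, ℂ), ∀ m (x : Z), (∀ j, π m j x ≠ 0 → 0 < δ j x) ∧
      p x (m - ∑ j, π m j x • e j x) = 0 := by
  choose a ha hm using h.span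
  refine ⟨fun m j => ⟨fun x => a x x.2 m j, ?_⟩, fun m x => ⟨ha x x.2 m, hm x x.2 m⟩⟩
  refine continuous_iff_continuousAt.2 fun x₀ => ?_
  set a₀ := a x₀ x₀.2 m with ha₀
  set W : Set X := Z ∩ {x | ∀ j, a₀ j ≠ 0 → 0 < δ j x} with hW
  have hWmem : W ∈ 𝓝[Z] (x₀ : X) := by
    refine inter_mem self_mem_nhdsWithin (eventually_all.2 fun j => ?_)
    by_cases hj : a₀ j = 0
    · simp [hj]
    · filter_upwards [(h.continuousOn j x₀ x₀.2).eventually_const_lt (ha x₀ x₀.2 m j hj)]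
        with x hx _ using hx
  have hcomb : IsCombOn W fun x => m - ∑ j, a₀ j • e j x :=
    (IsCombOn.const m).sub_sum a₀ fun j hj =>
      (h.comb j).mono fun x hx => ⟨hx.1, hx.2 j hj⟩
  have hcont := hcomb.continuousOn (fun m => (hp m).mono inter_subset_left) x₀
    (mem_of_mem_nhdsWithin x₀.2 hWmem)
  have h0 : p x₀ (m - ∑ j, a₀ j • e j x₀) = 0 := hm x₀ x₀.2 m
  have hlim : Tendsto (fun x => C * p x (m - ∑ j, a₀ j • e j x)) (𝓝[Z] (x₀ : X)) (𝓝 0) := by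
    have := (hcont.mono_of_mem_nhdsWithin hWmem).tendsto.const_mul C
    simpa only [h0, mul_zero] using this
  have hlim' := tendsto_nhdsWithin_iff_subtype x₀.2 _ _ |>.1 hlim
  rw [ContinuousAt, tendsto_iff_norm_sub_tendsto_zero]
  have hWmem' : ∀ᶠ x : Z in 𝓝 x₀, (x : X) ∈ W := by
    rw [nhdsWithin_eq_map_subtype_coe x₀.2] at hWmem
    exact hWmem
  refine squeeze_zero' (Eventually.of_forall fun x => norm_nonneg _) ?_ hlim'
  filter_upwards [hWmem'] with x hx
  exact h.norm_sub_le x.2 (ha x x.2 m) hx.2 (hm x x.2 m) j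

end IsFrameOn

end Frames

section BanachModule

variable {X M : Type*} [TopologicalSpace X]

lemma mem_IY {Y : Set X} {f : C(X, ℂ)} : f ∈ IY Y ↔ ∀ y ∈ Y, f y = 0 := Iff.rfl

lemma IY_anti {Y Y' : Set X} (h : Y ⊆ Y') : IY Y' ≤ IY Y := fun _ hf y hy => hf y (h hy)

variable [CompactSpace X]

lemma norm_ofRealCM_le_one {χ : C(X, ℝ)} (hχ : ∀ y, χ y ∈ Icc (0 : ℝ) 1) : ‖ofRealCM χ‖ ≤ 1 :=
  (ContinuousMap.norm_le _ zero_le_one).2 fun y =>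
    (Complex.norm_of_nonneg (hχ y).1).trans_le (hχ y).2

lemma exists_nhds_norm_smul_le_of_mem [NormedAddCommGroup M] [Module C(X, ℂ) M]
    (hnorm : ∀ (f : C(X, ℂ)) (m : M), ‖f • m‖ ≤ ‖f‖ * ‖m‖)
    {x : X} {u : M}    (hu : u ∈ IY {x} • (⊤ : Submodule C(X, ℂ) M)) {ε : ℝ} (hε : 0 < ε) :
    ∃ V ∈ 𝓝 x, ∀ χ : C(X, ℝ), (∀ y, χ y ∈ Icc (0 : ℝ) 1) → (∀ y ∉ V, χ y = 0) →
      ‖ofRealCM χ • u‖ ≤ ε := by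
  refine Submodule.smul_induction_on (p := fun u => ∀ ε > 0, ∃ V ∈ 𝓝 x, ∀ χ : C(X, ℝ),
    (∀ y, χ y ∈ Icc (0 : ℝ) 1) → (∀ y ∉ V, χ y = 0) → ‖ofRealCM χ • u‖ ≤ ε) hu ?_ ?_ ε hε
  · intro f hf n _ ε hε
    have hn : 0 < ‖n‖ + 1 := by positivity
    refine ⟨{y | ‖f y‖ < ε / (‖n‖ + 1)}, ?_, fun χ hχ hV => ?_⟩
    · refine (f.continuous.norm.tendsto x).eventually_lt_const ?_
      rw [mem_IY.1 hf x rfl, norm_zero]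
      positivity
    · have h : ‖ofRealCM χ * f‖ ≤ ε / (‖n‖ + 1) := by
        refine (ContinuousMap.norm_le _ (by positivity)).2 fun y => ?_
        rw [ContinuousMap.mul_apply, norm_mul]
        have h₁ : ‖ofRealCM χ y‖ = χ y := Complex.norm_of_nonneg (hχ y).1
        rw [h₁]
        by_cases hy : ‖f y‖ < ε / (‖n‖ + 1)
        · exact (mul_le_of_le_one_left (norm_nonneg _) (hχ y).2).trans hy.le
        · rw [hV y hy, zero_mul]
          positivity
      rw [smul_smul]
      refine (hnorm _ _).trans ((mul_le_mul_of_nonneg_right h (norm_nonneg _)).trans ?_)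
      rw [div_mul_eq_mul_div, div_le_iff₀ hn]
      nlinarith
  · intro u v hu hv ε hε
    obtain ⟨V, hV, h⟩ := hu _ (half_pos hε)
    obtain ⟨V', hV', h'⟩ := hv _ (half_pos hε)
    refine ⟨V ∩ V', inter_mem hV hV', fun χ hχ hW => ?_⟩
    rw [smul_add, ← add_halves ε]
    exact (norm_add_le _ _).trans (add_le_add
      (h χ hχ fun y hy => hW y fun hy' => hy hy'.1) (h' χ hχ fun y hy => hW y fun hy' => hy hy'.2))

lemma exists_cutoff [T2Space X] {Z : Set X} (hZ : IsClosed Z) {δ : X → ℝ} (hδ : ContinuousOn δ Z)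
    (g : C(Z, ℂ)) (hg : ∀ y : Z, ¬ 0 < δ y → g y = 0) {ε : ℝ} (hε : 0 < ε) :
    ∃ g' : X → ℂ, (∀ y : Z, ‖g' y - g y‖ ≤ ε) ∧ (∀ y ∈ Z, g' y ≠ 0 → 0 < δ y) ∧
      ∀ b : X → ℂ, ContinuousOn b (Z ∩ {x | 0 < δ x}) → ContinuousOn (fun x => g' x * b x) Z := by
  obtain ⟨G, hG⟩ := ContinuousMap.exists_restrict_eq hZ g
  have hGg : ∀ y : Z, G y = g y := fun y => DFunLike.congr_fun hG y
  have hpos : ∀ y ∈ Z, G y ≠ 0 → 0 < δ y := fun y hy h =>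
    by_contra fun h' => h ((hGg ⟨y, hy⟩).trans (hg ⟨y, hy⟩ h'))
  set c : X → ℝ := fun x => max 0 (‖G x‖ - ε) / max ‖G x‖ ε with hc
  have hmax : ∀ x, 0 < max ‖G x‖ ε := fun x => lt_max_of_lt_right hε
  have hcc : Continuous c := by
    refine Continuous.div (by fun_prop) (by fun_prop) fun x => (hmax x).ne'
  refine ⟨fun x => G x * c x, fun y => ?_, fun y hy h => hpos y hy (left_ne_zero_of_mul h), ?_⟩
  · rw [← hGg, ← mul_sub_one, norm_mul, ← Complex.ofReal_one, ← Complex.ofReal_sub,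
      Complex.norm_real, Real.norm_eq_abs]
    rcases le_total ‖G y‖ ε with h | h
    · simpa [hc, max_eq_left (sub_nonpos.2 h)] using h
    · have h0 : 0 < ‖G y‖ := hε.trans_le h
      have : c y - 1 = -(ε / ‖G y‖) := by
        simp only [hc, max_eq_right (sub_nonneg.2 h), max_eq_left h]
        field_simp
        ring
      rw [this, abs_neg, abs_of_pos (by positivity), mul_div_cancel₀ _ h0.ne']
  · intro b hb x hx
    by_cases h : ‖G x‖ < ε
    · have : (fun x => G x * c x * b x) =ᶠ[𝓝 x] fun _ => 0 := by
        filter_upwards [G.continuous.norm.continuousAt.eventually_lt_const h] with y hy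
        simp [hc, max_eq_left (sub_nonpos.2 hy.le)]
      exact (continuousAt_const.congr this.symm).continuousWithinAt
    · have hxδ : 0 < δ x := hpos x hx (norm_pos_iff.1 (hε.trans_le (not_lt.1 h)))
      have hb' : ContinuousWithinAt b Z x := by
        refine (hb x ⟨hx, hxδ⟩).mono_of_mem_nhdsWithin (inter_mem self_mem_nhdsWithin ?_)
        exact (hδ x hx).eventually_const_lt hxδ
      refine ContinuousWithinAt.mul ?_ hb'
      exact (G.continuous.mul (Complex.continuous_ofReal.comp hcc)).continuousWithinAt

variable [NormedAddCommGroup M] [NormedSpace ℂ M]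
    [Module C(X, ℂ) M] [IsScalarTower ℂ C(X, ℂ) M]

/-- The norm on the fiber `M / closure (IY {x} • M)`, pulled back to `M`. -/
noncomputable def fiberSeminorm (M : Type*) [NormedAddCommGroup M] [NormedSpace ℂ M]
    [Module C(X, ℂ) M] [IsScalarTower ℂ C(X, ℂ) M] (x : X) : Seminorm ℂ M :=
  (normSeminorm ℂ (M ⧸ (IY {x} • (⊤ : Submodule C(X, ℂ) M)).restrictScalars ℂ)).comp
    ((IY {x} • (⊤ : Submodule C(X, ℂ) M)).restrictScalars ℂ).mkQ

lemma fiberSeminorm_apply (x : X) (m : M) : fiberSeminorm M x m =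
    Metric.infDist m ((IY {x} • (⊤ : Submodule C(X, ℂ) M) : Submodule C(X, ℂ) M) : Set M) :=
  QuotientAddGroup.norm_mk
    (S := ((IY {x} • (⊤ : Submodule C(X, ℂ) M)).restrictScalars ℂ).toAddSubgroup) m

lemma fiberSeminorm_le_norm (x : X) (m : M) : fiberSeminorm M x m ≤ ‖m‖ :=
  Submodule.Quotient.norm_mk_le _ m

lemma fiberSeminorm_eq_zero {Y : Set X} {x : X} (hx : x ∈ Y) {m : M}
    (hm : m ∈ closure ((IY Y • (⊤ : Submodule C(X, ℂ) M) : Submodule C(X, ℂ) M) : Set M)) :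
    fiberSeminorm M x m = 0 := by
  rw [fiberSeminorm_apply, ← Metric.mem_closure_iff_infDist_zero ⟨0, zero_mem _⟩]
  exact closure_mono (Submodule.smul_mono_left (IY_anti (singleton_subset_iff.2 hx))) hm

lemma fiberSeminorm_smul_sub_smul (x : X) (f : C(X, ℂ)) (m : M) :
    fiberSeminorm M x (f • m - f x • m) = 0 := by
  refine fiberSeminorm_eq_zero (mem_singleton x) (subset_closure ?_)
  have : f • m - f x • m = (f - f x • (1 : C(X, ℂ))) • m := by
    rw [sub_smul, smul_assoc, one_smul]
  rw [this]
  refine Submodule.smul_mem_smul (mem_IY.2 ?_) Submodule.mem_top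
  simp

lemma exists_nhds_norm_smul_le
    (hnorm : ∀ (f : C(X, ℂ)) (m : M), ‖f • m‖ ≤ ‖f‖ * ‖m‖)
    {x : X} {m : M} {r : ℝ} (hm : fiberSeminorm M x m < r) :
    ∃ V ∈ 𝓝 x, ∀ χ : C(X, ℝ), (∀ y, χ y ∈ Icc (0 : ℝ) 1) → (∀ y ∉ V, χ y = 0) →
      ‖ofRealCM χ • m‖ ≤ r := by
  rw [fiberSeminorm_apply, Metric.infDist_lt_iff ⟨0, zero_mem _⟩] at hm
  obtain ⟨u, hu, hmu⟩ := hm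
  obtain ⟨V, hV, h⟩ := exists_nhds_norm_smul_le_of_mem hnorm hu (sub_pos.2 hmu)
  refine ⟨V, hV, fun χ hχ hχV => ?_⟩
  rw [← sub_add_cancel m u, smul_add]
  have h₁ : ‖ofRealCM χ • (m - u)‖ ≤ dist m u := by
    rw [dist_eq_norm]
    exact (hnorm _ _).trans
      (mul_le_of_le_one_left (norm_nonneg _) (norm_ofRealCM_le_one hχ))
  linarith [norm_add_le (ofRealCM χ • (m - u)) (ofRealCM χ • u), h χ hχ hχV]

variable [T2Space X]

/-- The norm of a quotient by `IY Y • M` is controlled by the fiber norms over `Y`. -/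
lemma exists_mem_norm_sub_le
    (hnorm : ∀ (f : C(X, ℂ)) (m : M), ‖f • m‖ ≤ ‖f‖ * ‖m‖)
    (hconv : ∀ f : C(X, ℝ), (∀ x, f x ∈ Icc (0 : ℝ) 1) →
      ∀ m m' : M, ‖ofRealCM f • m + (1 - ofRealCM f) • m'‖ ≤ max ‖m‖ ‖m'‖)
    {Y : Set X} (hY : IsClosed Y) {m : M} {r : ℝ} (hr : 0 ≤ r)
    (hm : ∀ x ∈ Y, fiberSeminorm M x m < r) :
    ∃ u ∈ IY Y • (⊤ : Submodule C(X, ℂ) M), ‖m - u‖ ≤ r := by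
  have urysohn : ∀ K V : Set X, IsClosed K → IsOpen V → K ⊆ V → ∃ f : C(X, ℝ),
      (∀ y, f y ∈ Icc (0 : ℝ) 1) ∧ (∀ y ∈ K, f y = 1) ∧ ∀ y ∉ V, f y = 0 := by
    intro K V hK hV hKV
    obtain ⟨f, hf0, hf1, hf⟩ := exists_continuous_zero_one_of_isClosed hV.isClosed_compl hK
      (disjoint_compl_left_iff_subset.2 hKV)
    exact ⟨f, hf, fun y hy => hf1 hy, fun y hy => hf0 hy⟩
  have key : ∃ W, IsOpen W ∧ closure Y ⊆ W ∧ ∀ χ : C(X, ℝ), (∀ y, χ y ∈ Icc (0 : ℝ) 1) →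
      (∀ y ∉ W, χ y = 0) → ‖ofRealCM χ • m‖ ≤ r := by
    refine hY.isCompact.induction_on (p := fun Y => ∃ W, IsOpen W ∧ closure Y ⊆ W ∧
      ∀ χ : C(X, ℝ), (∀ y, χ y ∈ Icc (0 : ℝ) 1) → (∀ y ∉ W, χ y = 0) → ‖ofRealCM χ • m‖ ≤ r)
      ?_ ?_ ?_ ?_
    · refine ⟨∅, isOpen_empty, by simp, fun χ _ h => ?_⟩
      have : ofRealCM χ = 0 := by ext y; simp [ofRealCM, h y]
      simpa [this] using hr
    · rintro s t hst ⟨W, hW, htW, h⟩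
      exact ⟨W, hW, (closure_mono hst).trans htW, h⟩
    · rintro s t ⟨W, hW, hsW, h⟩ ⟨W', hW', htW, h'⟩
      obtain ⟨V, hV, hsV, hVW⟩ := normal_exists_closure_subset isClosed_closure hW hsW
      obtain ⟨V₂, hV₂, hVV₂, hV₂W⟩ := normal_exists_closure_subset isClosed_closure hW hVW
      obtain ⟨V', hV', htV', hVW'⟩ := normal_exists_closure_subset isClosed_closure hW' htW
      obtain ⟨f, hf, hf1, hf0⟩ := urysohn _ _ isClosed_closure hV₂ hVV₂
      obtain ⟨φ, hφ, hφ1, hφ0⟩ := urysohn _ _ isClosed_closure hW hV₂W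
      obtain ⟨ψ, hψ, hψ1, hψ0⟩ := urysohn _ _ isClosed_closure hW' hVW'
      refine ⟨V ∪ V', hV.union hV', ?_, fun χ hχ hχV => ?_⟩
      · rw [closure_union]
        exact union_subset_union hsV htV'
      have hmul : ∀ g : C(X, ℝ), (∀ y, g y ∈ Icc (0 : ℝ) 1) → ∀ y, (χ * g) y ∈ Icc (0 : ℝ) 1 :=
        fun g hg y => ⟨mul_nonneg (hχ y).1 (hg y).1, mul_le_one₀ (hχ y).2 (hg y).1 (hg y).2⟩
      have h₁ := h (χ * φ) (hmul φ hφ) fun y hy => by simp [hφ0 y hy]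
      have h₂ := h' (χ * ψ) (hmul ψ hψ) fun y hy => by simp [hψ0 y hy]
      have heq : ofRealCM χ = ofRealCM f * ofRealCM (χ * φ) +
          (1 - ofRealCM f) * ofRealCM (χ * ψ) := by
        have hreal : ∀ y, χ y = f y * (χ y * φ y) + (1 - f y) * (χ y * ψ y) := by
          intro y
          have e₁ : f y * φ y = f y := by
            by_cases hy : y ∈ V₂
            · rw [hφ1 y (subset_closure hy), mul_one]
            · rw [hf0 y hy, zero_mul]
          have e₂ : (1 - f y) * (χ y * ψ y) = (1 - f y) * χ y := by
            by_cases hy : y ∈ V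
            · simp [hf1 y (subset_closure hy)]
            by_cases hy' : y ∈ V'
            · rw [hψ1 y (subset_closure hy'), mul_one]
            · simp [hχV y fun h => h.elim hy hy']
          rw [e₂]
          linear_combination (-χ y) * e₁
        ext y
        simpa [ofRealCM] using congrArg (fun t : ℝ => (t : ℂ)) (hreal y)
      rw [heq, add_smul, mul_smul, mul_smul]
      exact (hconv f hf _ _).trans (max_le h₁ h₂)
    · intro x hx
      obtain ⟨V, hV, h⟩ := exists_nhds_norm_smul_le hnorm (hm x hx)
      obtain ⟨V₁, hV₁, hV₁o, hxV₁⟩ := mem_nhds_iff.1 hV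
      obtain ⟨t, ht, htc, htV⟩ := exists_mem_nhds_isClosed_subset (hV₁o.mem_nhds hxV₁)
      exact ⟨t, mem_nhdsWithin_of_mem_nhds ht, V₁, hV₁o, htc.closure_eq.trans_subset htV,
        fun χ hχ hχV => h χ hχ fun y hy => hχV y fun hy' => hy (hV₁ hy')⟩
  obtain ⟨W, hW, hYW, h⟩ := key
  obtain ⟨χ, hχ, hχ1, hχ0⟩ := urysohn _ W isClosed_closure hW hYW
  refine ⟨(1 - ofRealCM χ) • m, Submodule.smul_mem_smul (mem_IY.2 fun y hy => ?_)
    Submodule.mem_top, ?_⟩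
  · simp [ofRealCM, hχ1 y (subset_closure hy)]
  · rw [sub_smul, one_smul, sub_sub_cancel]
    exact h χ hχ hχ0

/-- A section cut off by a scalar function is represented on `Z` by an element of `M`. -/
lemma IsCombOn.exists_fiberSeminorm_sub_eq_zero {W Z : Set X} (hZ : IsClosed Z) {F : X → M}
    (hF : IsCombOn W F) {g : X → ℂ}
    (hg : ∀ b : X → ℂ, ContinuousOn b W → ContinuousOn (fun x => g x * b x) Z) :
    ∃ m : M, ∀ x ∈ Z, fiberSeminorm M x (m - g x • F x) = 0 := by
  induction hF with
  | @smul b hb m =>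
    obtain ⟨f, hf⟩ := ContinuousMap.exists_restrict_eq hZ
      ⟨_, continuousOn_iff_continuous_domRestrict.1 (hg b hb)⟩
    refine ⟨f • m, fun x hx => ?_⟩
    have : f x = g x * b x := DFunLike.congr_fun hf ⟨x, hx⟩
    rw [smul_smul, ← this]
    exact fiberSeminorm_smul_sub_smul x f m
  | add _ _ hF hG =>
    obtain ⟨m, hm⟩ := hF
    obtain ⟨n, hn⟩ := hG
    refine ⟨m + n, fun x hx => le_antisymm ?_ (apply_nonneg _ _)⟩
    rw [smul_add, add_sub_add_comm]
    exact (map_add_le_add _ _ _).trans (by rw [hm x hx, hn x hx, add_zero])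

end BanachModule

section Trivialization

variable {X M : Type*} [TopologicalSpace X] [CompactSpace X] [T2Space X]
    [NormedAddCommGroup M] [CompleteSpace M] [NormedSpace ℂ M]
    [Module C(X, ℂ) M] [IsScalarTower ℂ C(X, ℂ) M]

lemma IsFrameOn.exists_equivariant_isOpenMap
    (hnorm : ∀ (f : C(X, ℂ)) (m : M), ‖f • m‖ ≤ ‖f‖ * ‖m‖)
    (hconv : ∀ f : C(X, ℝ), (∀ x, f x ∈ Icc (0 : ℝ) 1) →
      ∀ m m' : M, ‖ofRealCM f • m + (1 - ofRealCM f) • m'‖ ≤ max ‖m‖ ‖m'‖)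
    {Z : Set X} (hZ : IsClosed Z) (hp : ∀ m, ContinuousOn (fun x => fiberSeminorm M x m) Z)
    {k : ℕ} {δ : Fin k → X → ℝ} {e : Fin k → X → M} {C : ℝ}
    (h : IsFrameOn (fiberSeminorm M) Z δ e C) :
    ∃ π : M → (Fin k → C(Z, ℂ)), Continuous π ∧ (∀ m m' : M, π (m + m') = π m + π m') ∧
      (∀ (f : C(X, ℂ)) (m : M) (j : Fin k), π (f • m) j = f.restrict Z * π m j) ∧
      (∀ (m : M) (j : Fin k) (y : Z), ¬ 0 < δ j y → π m j y = 0) ∧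
      (∀ g : Fin k → C(Z, ℂ), (∀ (j : Fin k) (y : Z), ¬ 0 < δ j y → g j y = 0) → ∃ m, π m = g) ∧
      (∀ m : M, π m = 0 ↔
        m ∈ closure ((IY Z • (⊤ : Submodule C(X, ℂ) M) : Submodule C(X, ℂ) M) : Set M)) ∧
      ∀ S : Set M, IsOpen S → ∃ T : Set (Fin k → C(Z, ℂ)), IsOpen T ∧
        π '' S = T ∩ {g | ∀ (j : Fin k) (y : Z), ¬ 0 < δ j y → g j y = 0} := by
  have hZc : CompactSpace Z := isCompact_iff_compactSpace.1 hZ.isCompact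
  have hC := h.nonneg
  obtain ⟨π, hπ⟩ := h.exists_coordinates hp
  have huniq : ∀ (m : M) (a : Fin k → Z → ℂ), (∀ y j, a j y ≠ 0 → 0 < δ j y) →
      (∀ y : Z, fiberSeminorm M (y : X) (m - ∑ j, a j y • e j y) = 0) → ∀ j y, π m j y = a j y :=
    fun m a ha hm j y => congrFun (h.eq_of_map_sub_eq_zero y.2 (a := fun j => π m j y)
      (a' := fun j => a j y) (hπ m y).1 (ha y) (hπ m y).2 (hm y)) j
  have hadd : ∀ m m' : M, π (m + m') = π m + π m' := by
    intro m m'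
    ext j y
    refine huniq (m + m') (fun j y => π m j y + π m' j y) (fun y j hj => ?_) (fun y => ?_) j y
    · by_contra hδ
      have h₁ : π m j y = 0 := by_contra fun h => hδ ((hπ m y).1 j h)
      have h₂ : π m' j y = 0 := by_contra fun h => hδ ((hπ m' y).1 j h)
      simp [h₁, h₂] at hj
    · simp only [add_smul, Finset.sum_add_distrib, add_sub_add_comm]
      refine le_antisymm ((map_add_le_add _ _ _).trans ?_) (apply_nonneg _ _)
      rw [(hπ m y).2, (hπ m' y).2, add_zero]
  have hmul : ∀ (f : C(X, ℂ)) (m : M) (j : Fin k), π (f • m) j = f.restrict Z * π m j := by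
    intro f m j
    ext y
    refine huniq (f • m) (fun j y => f y * π m j y)
      (fun y j hj => (hπ m y).1 j (right_ne_zero_of_mul hj)) (fun y => ?_) j y
    have : f • m - ∑ j, (f y * π m j y) • e j y =
        (f • m - f y • m) + f y • (m - ∑ j, π m j y • e j y) := by
      simp only [mul_smul, smul_sub, Finset.smul_sum]
      abel
    rw [this]
    refine le_antisymm ((map_add_le_add _ _ _).trans ?_) (apply_nonneg _ _)
    rw [fiberSeminorm_smul_sub_smul, map_smul_eq_mul, (hπ m y).2, mul_zero, add_zero]
  have hvan : ∀ (m : M) (j : Fin k) (y : Z), ¬ 0 < δ j y → π m j y = 0 :=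
    fun m j y hy => by_contra fun h => hy ((hπ m y).1 j h)
  have hle : ∀ (m : M) (y : Z) j, ‖π m j y‖ ≤ C * fiberSeminorm M (y : X) m := by
    intro m y j
    simpa using h.norm_sub_le y.2 (a' := 0) (hπ m y).1 (by simp) (hπ m y).2 j
  have hle' : ∀ (m : M) (y : Z), fiberSeminorm M (y : X) m ≤ k * C * ‖π m‖ := by
    intro m y
    rw [Seminorm.map_eq_of_map_sub_eq_zero (hπ m y).2]
    refine (Finset.le_sum_of_subadditive _ (map_zero _).le (map_add_le_add _) _ _).trans ?_
    refine (Finset.sum_le_card_nsmul _ _ (C * ‖π m‖) fun j _ => ?_).trans_eq (by simp; ring)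
    rw [map_smul_eq_mul]
    by_cases hj : π m j y = 0
    · rw [hj, norm_zero, zero_mul]; positivity
    · rw [mul_comm]
      exact mul_le_mul (h.le j y y.2 ((hπ m y).1 j hj))
        (((π m j).norm_coe_le_norm y).trans (norm_le_pi_norm (π m) j)) (norm_nonneg _) hC
  have hsmul : ∀ (c : ℂ) (m : M), π (c • m) = c • π m := by
    intro c m
    ext j y
    have := DFunLike.congr_fun (hmul (c • 1) m j) y
    rw [smul_assoc, one_smul] at this
    simpa using this
  have hbound : ∀ m, ‖π m‖ ≤ C * ‖m‖ := fun m =>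
    (pi_norm_le_iff_of_nonneg (by positivity)).2 fun j =>
      (ContinuousMap.norm_le _ (by positivity)).2 fun y =>
        (hle m y j).trans (mul_le_mul_of_nonneg_left (fiberSeminorm_le_norm _ _) hC)
  have hker : ∀ m : M, π m = 0 ↔
      m ∈ closure ((IY Z • (⊤ : Submodule C(X, ℂ) M) : Submodule C(X, ℂ) M) : Set M) := by
    refine fun m => ⟨fun hm => Metric.mem_closure_iff.2 fun ε hε => ?_, fun hm => ?_⟩
    · obtain ⟨u, hu, hmu⟩ := exists_mem_norm_sub_le hnorm hconv hZ (half_pos hε).le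
        (m := m) fun x hx => ((hle' m ⟨x, hx⟩).trans_eq (by rw [hm]; simp)).trans_lt (half_pos hε)
      exact ⟨u, hu, by rw [dist_eq_norm]; exact hmu.trans_lt (half_lt_self hε)⟩
    · ext j y
      have := hle m y j
      rw [fiberSeminorm_eq_zero y.2 hm, mul_zero] at this
      simpa using this
  set G : Submodule ℂ (Fin k → C(Z, ℂ)) :=
    { carrier := {g | ∀ (j : Fin k) (y : Z), ¬ 0 < δ j y → g j y = 0}
      add_mem' := fun ha hb j y hy => by simp [ha j y hy, hb j y hy]
      zero_mem' := fun j y _ => rfl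
      smul_mem' := fun c a ha j y hy => by simp [ha j y hy] } with hG
  have hGc : IsClosed (G : Set (Fin k → C(Z, ℂ))) := by
    have : (G : Set (Fin k → C(Z, ℂ))) =
        ⋂ (j : Fin k) (y : Z) (_ : ¬ 0 < δ j y), {g | g j y = 0} := by
      ext g
      simp [hG]
    rw [this]
    exact isClosed_iInter fun j => isClosed_iInter fun y => isClosed_iInter fun _ =>
      isClosed_eq (by fun_prop) continuous_const
  let L : M →ₗ[ℂ] Fin k → C(Z, ℂ) := { toFun := π, map_add' := hadd, map_smul' := hsmul }
  let P : M →L[ℂ] Fin k → C(Z, ℂ) := L.mkContinuous C hbound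
  let N : NormedAddGroupHom M (Fin k → C(Z, ℂ)) := L.toAddMonoidHom.mkNormedAddGroupHom C hbound
  have hdense : ∀ g ∈ G, ∀ ε > 0, ∃ m, ‖π m - g‖ ≤ ε := by
    intro g hg ε hε
    choose g' hg₁ hg₂ hg₃ using fun j => exists_cutoff hZ (h.continuousOn j) (g j) (hg j) hε
    choose m hm using fun j => (h.comb j).exists_fiberSeminorm_sub_eq_zero hZ (hg₃ j)
    refine ⟨∑ j, m j, (pi_norm_le_iff_of_nonneg hε.le).2 fun j =>
      (ContinuousMap.norm_le _ hε.le).2 fun y => ?_⟩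
    have := huniq (∑ j, m j) (fun j y => g' j y) (fun y j hj => hg₂ j y y.2 hj) (fun y => ?_) j y
    · simpa [this] using hg₁ j y
    · rw [← Finset.sum_sub_distrib]
      refine le_antisymm ((Finset.le_sum_of_subadditive _ (map_zero _).le (map_add_le_add _)
        _ _).trans ?_) (apply_nonneg _ _)
      exact (Finset.sum_eq_zero fun j _ => hm j y y.2).le
  have hsurj : ∀ g ∈ G, ∃ m, π m = g := by
    have hrange : N.SurjectiveOnWith N.range (k * C + 1) := by
      rintro _ ⟨m, rfl⟩
      by_cases hm : π m = 0
      · exact ⟨0, (map_zero N).trans hm.symm, by rw [norm_zero]; positivity⟩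
      have hpos : 0 < ‖π m‖ := norm_pos_iff.2 hm
      obtain ⟨u, hu, hmu⟩ := exists_mem_norm_sub_le hnorm hconv hZ
        (r := (k * C + 1) * ‖π m‖) (by positivity) (m := m) fun x hx =>
          (hle' m ⟨x, hx⟩).trans_lt (by linarith)
      refine ⟨m - u, ?_, hmu⟩
      have : P u = 0 := (hker u).2 (subset_closure hu)
      change P (m - u) = P m
      rw [map_sub, this, sub_zero]
    intro g hg
    obtain ⟨m, hm, -⟩ := controlled_closure_of_complete (C := k * C + 1) (by positivity)
      one_pos hrange g
      (Metric.mem_closure_iff.2 fun ε hε => by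
        obtain ⟨m, hm⟩ := hdense g hg (ε / 2) (half_pos hε)
        refine ⟨π m, ⟨m, rfl⟩, ?_⟩
        rw [dist_comm, dist_eq_norm]
        exact hm.trans_lt (half_lt_self hε))
    exact ⟨m, hm⟩
  refine ⟨π, P.continuous, hadd, hmul, hvan, hsurj, hker, fun S hS => ?_⟩
  have : CompleteSpace G := hGc.completeSpace_coe
  let Q : M →L[ℂ] G := P.codRestrict G hvan
  have hQ : Function.Surjective Q := fun g =>
    (hsurj g g.2).imp fun m hm => Subtype.ext hm
  obtain ⟨T, hT, hTQ⟩ := isOpen_induced_iff.1 (Q.isOpenMap hQ S hS)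
  refine ⟨T, hT, ?_⟩
  change (fun m => (Q m : Fin k → C(Z, ℂ))) '' S = T ∩ (G : Set (Fin k → C(Z, ℂ)))
  rw [← image_image (fun g : G => (g : Fin k → C(Z, ℂ))) Q S, ← hTQ]
  exact (Subtype.image_preimage_coe _ _).trans (inter_comm _ _)

end Trivialization

/-- For a topologically finitely generated, `C(X)`-convex unital Banach
`C(X,ℂ)`-module `M` with continuous fiber norms over compact Hausdorff `X`,
there is a finite closed cover `X = Y_1 ∪ ⋯ ∪ Y_n` such that each quotient
`M / closure(I_{Y_i} • M)` is isomorphic, via a `C(X,ℂ)`-linear homeomorphism,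
to a finite direct sum `⊕_j C_0(U_{i,j})` for open `F_σ` subsets `U_{i,j} ⊆ Y_i`.
The isomorphism of the quotient is encoded by a continuous, open (onto the
direct sum), additive and `C(X,ℂ)`-equivariant surjection `π` with
`π⁻¹(0) = closure(I_{Y_i} • M)`. -/
theorem stmt7 {X M : Type*} [TopologicalSpace X] [CompactSpace X] [T2Space X]
    [NormedAddCommGroup M] [CompleteSpace M] [NormedSpace ℂ M]
    [Module C(X, ℂ) M] [IsScalarTower ℂ C(X, ℂ) M]
    (hnorm : ∀ (f : C(X, ℂ)) (m : M), ‖f • m‖ ≤ ‖f‖ * ‖m‖)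
    (hconv : ∀ f : C(X, ℝ), (∀ x, f x ∈ Set.Icc (0 : ℝ) 1) →
      ∀ m m' : M, ‖ofRealCM f • m + (1 - ofRealCM f) • m'‖ ≤ max ‖m‖ ‖m'‖)
    (hfib : ∀ m : M, Continuous fun x : X =>
      Metric.infDist m ((IY {x} • (⊤ : Submodule C(X, ℂ) M) : Submodule C(X, ℂ) M) : Set M))
    (htfg : ∃ s : Finset M,
      Dense ((Submodule.span C(X, ℂ) (s : Set M) : Submodule C(X, ℂ) M) : Set M)) :
    ∃ n : ℕ, 0 < n ∧ ∃ Y : Fin n → Set X,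
      (∀ i, IsClosed (Y i)) ∧ (⋃ i, Y i) = Set.univ ∧
      ∀ i : Fin n, ∃ (k : ℕ) (U : Fin k → Set (Y i)),
        (∀ j, IsOpen (U j) ∧
          ∃ F : ℕ → Set (Y i), (∀ l, IsClosed (F l)) ∧ U j = ⋃ l, F l) ∧
        ∃ π : M → (Fin k → C((Y i : Set X), ℂ)),
          Continuous π ∧
          (∀ m m' : M, π (m + m') = π m + π m') ∧
          (∀ (f : C(X, ℂ)) (m : M) (j : Fin k), π (f • m) j = f.restrict (Y i) * π m j) ∧
          (∀ (m : M) (j : Fin k) (y : Y i), y ∉ U j → π m j y = 0) ∧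
          (∀ g : Fin k → C((Y i : Set X), ℂ),
            (∀ (j : Fin k) (y : Y i), y ∉ U j → g j y = 0) → ∃ m : M, π m = g) ∧
          (∀ m : M, π m = 0 ↔
            m ∈ closure ((IY (Y i) • (⊤ : Submodule C(X, ℂ) M) : Submodule C(X, ℂ) M) : Set M)) ∧
          (∀ S : Set M, IsOpen S →
            ∃ T : Set (Fin k → C((Y i : Set X), ℂ)), IsOpen T ∧
              π '' S = T ∩ {g | ∀ (j : Fin k) (y : Y i), y ∉ U j → g j y = 0}) := by
  obtain ⟨s, hs⟩ := htfg
  have hp : ∀ m : M, Continuous fun x : X => fiberSeminorm M x m := by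
    simpa only [fiberSeminorm_apply] using hfib
  have hgen : ∀ x ∈ (univ : Set X), ∀ m : M, ∀ ε > 0, ∃ c : Fin s.card → ℂ,
      fiberSeminorm M x (m - ∑ i, c i • (s.equivFin.symm i : M)) < ε := by
    intro x _ m ε hε
    obtain ⟨u, hu, hmu⟩ := Metric.mem_closure_iff.1 (hs m) ε hε
    have hrange : (s : Set M) = range fun i => (s.equivFin.symm i : M) := by
      rw [← Function.comp_def, EquivLike.range_comp, Subtype.range_coe]
    rw [hrange, SetLike.mem_coe, Submodule.mem_span_range_iff_exists_fun] at hu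
    obtain ⟨f, rfl⟩ := hu
    refine ⟨fun i => f i x, lt_of_le_of_lt ?_ hmu⟩
    rw [dist_eq_norm]
    refine (Seminorm.map_eq_of_map_sub_eq_zero ?_).trans_le (fiberSeminorm_le_norm x _)
    rw [sub_sub_sub_cancel_left, ← Finset.sum_sub_distrib]
    refine le_antisymm ((Finset.le_sum_of_subadditive _ (map_zero _).le (map_add_le_add _)
      _ _).trans ?_) (apply_nonneg _ _)
    exact (Finset.sum_eq_zero fun i _ => fiberSeminorm_smul_sub_smul x _ _).le
  obtain ⟨ι, _, _, Z, hZc, -, hZ, hframe⟩ := exists_isFrameOn_cover (fiberSeminorm M)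
    isClosed_univ (fun m => (hp m).continuousOn) _ hgen
  obtain ⟨n, ⟨φ⟩⟩ := Finite.exists_equiv_fin ι
  refine ⟨n, Fin.pos_iff_nonempty.2 ⟨φ (Classical.arbitrary ι)⟩, Z ∘ φ.symm, fun i => hZc _, ?_,
    fun i => ?_⟩
  · rw [← univ_subset_iff]
    refine hZ.trans (iUnion_subset fun i => ?_)
    simpa using subset_iUnion (Z ∘ φ.symm) (φ i)
  · obtain ⟨k, δ, e, C, h⟩ := hframe (φ.symm i)
    have hδ : ∀ j, Continuous fun y : Z (φ.symm i) => δ j y := fun j =>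
      continuousOn_iff_continuous_domRestrict.1 (h.continuousOn j)
    refine ⟨k, fun j => {y | 0 < δ j y}, fun j => ⟨isOpen_lt continuous_const (hδ j),
      fun l => {y | 1 / ((l : ℝ) + 1) ≤ δ j y}, fun l => isClosed_le continuous_const (hδ j), ?_⟩,
      h.exists_equivariant_isOpenMap hnorm hconv (hZc _) fun m => (hp m).continuousOn⟩
    ext y
    simp only [mem_iUnion, mem_ofPred_eq]
    exact ⟨fun h => (exists_nat_one_div_lt h).imp fun l hl => hl.le,
      fun ⟨l, hl⟩ => Nat.one_div_pos_of_nat.trans_le hl⟩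
end
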